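/- Let b > 0, γ_a > 0, γ_e > 0 and (x_i, y_i, z_i) ∈ ℝ³ with (x_i, y_i, z_i) ≠ (0, 0, 0). Suppose v* = (v₁*, v₂*) ∈ V is a local maximizer of h_i on V. Then exactly one of the following cases describes v*, and in each case the stated first-order conditions hold: (a) if |v₁*| < γ_a and |v₂*| < γ_e then x_i ≠ 0 and v* = (y_i/x_i, z_i/x_i); (b) if v₁* = -γ_a and |v₂*| < γ_e then v₂*(x_i - γ_a y_i) = (1 + γ_a²)z_i and ∂h_i/∂v₁(v*) ≤ 0; (c) if v₁* = γ_a and |v₂*| < γ_e then v₂*(x_i + γ_a y_i) = (1 + γ_a²)z_i and ∂h_i/∂v₁(v*) ≥ 0; (d) if |v₁*| < γ_a and v₂* = -γ_e then v₁*(x_i - γ_e z_i) = (1 + γ_e²)y_i and ∂h_i/∂v₂(v*) ≤ 0; (e) if |v₁*| < γ_a and v₂* = γ_e then v₁*(x_i + γ_e z_i) = (1 + γ_e²)y_i and ∂h_i/∂v₂(v*) ≥ 0; (f) if v* is one of the four corners (±γ_a, ±γ_e), then the partial derivative in each coordinate is ≤ 0 when that coordinate sits at its lower bound and ≥ 0 when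 it sits at its upper bound. -/

import Mathlib

/-- The function `h_i` of Lemma 1. -/
noncomputable def hfun (b xi yi zi : ℝ) (v : ℝ × ℝ) : ℝ :=
  -2 * b * (xi + yi * v.1 + zi * v.2) / Real.sqrt (1 + v.1 ^ 2 + v.2 ^ 2)
    + (xi ^ 2 + yi ^ 2 + zi ^ 2) + b ^ 2

/-- The box `V = [-γ_a, γ_a] × [-γ_e, γ_e]`. -/
def Vbox (γa γe : ℝ) : Set (ℝ × ℝ) := Set.Icc (-γa) γa ×ˢ Set.Icc (-γe) γe

lemma aux_deriv (b A B C D : ℝ) (hC : 0 < C) (u : ℝ) :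
    HasDerivAt (fun u : ℝ => -2 * b * (A + B * u) / Real.sqrt (C + u ^ 2) + D)
      (-2 * b * (B * C - u * A) / (Real.sqrt (C + u ^ 2)) ^ 3) u := by
  have hp : 0 < C + u ^ 2 := by positivity
  have hs : 0 < Real.sqrt (C + u ^ 2) := Real.sqrt_pos.mpr hp
  have hsq : Real.sqrt (C + u ^ 2) ^ 2 = C + u ^ 2 := Real.sq_sqrt hp.le
  have h1 : HasDerivAt (fun u : ℝ => C + u ^ 2) (2 * u) u := by
    simpa using (hasDerivAt_pow 2 u).const_add C
  have h2 := h1.sqrt hp.ne'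
  have h3 : HasDerivAt (fun u : ℝ => -2 * b * (A + B * u)) (-2 * b * B) u := by
    simpa using (((hasDerivAt_id u).const_mul B).const_add A).const_mul (-2 * b)
  have h4 := (h3.div h2 hs.ne').add_const D
  refine h4.congr_deriv ?_
  set s := Real.sqrt (C + u ^ 2)
  have hCe : C = s ^ 2 - u ^ 2 := by linarith
  rw [hCe]
  field_simp
  ring

lemma aux_max (f : ℝ → ℝ) (c t : ℝ) (hc : 0 < c) (hf : DifferentiableAt ℝ f t)
    (hm : IsLocalMaxOn f (Set.Icc (-c) c) t) :
    (|t| < c → deriv f t = 0) ∧ (t = -c → deriv f t ≤ 0) ∧ (t = c → 0 ≤ deriv f t) := by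
  have hd := hf.hasDerivAt.hasFDerivAt.hasFDerivWithinAt (s := Set.Icc (-c) c)
  refine ⟨fun h => ?_, fun h => ?_, fun h => ?_⟩
  · have h' := abs_lt.mp h
    exact (hm.isLocalMax (Icc_mem_nhds h'.1 h'.2)).deriv_eq_zero
  · have hy : c - t ∈ posTangentConeAt (Set.Icc (-c) c) t := by
      apply sub_mem_posTangentConeAt_of_segment_subset
      apply (convex_Icc (-c) c).segment_subset <;> constructor <;> linarith
    have := hm.hasFDerivWithinAt_nonpos hd hy
    simp at this
    nlinarith
  · have hy : -c - t ∈ posTangentConeAt (Set.Icc (-c) c) t := by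
      apply sub_mem_posTangentConeAt_of_segment_subset
      apply (convex_Icc (-c) c).segment_subset <;> constructor <;> linarith
    have := hm.hasFDerivWithinAt_nonpos hd hy
    simp at this
    nlinarith

lemma aux_zero (b A B C u : ℝ) (hb : 0 < b) (hC : 0 < C)
    (h : -2 * b * (B * C - u * A) / (Real.sqrt (C + u ^ 2)) ^ 3 = 0) : u * A = C * B := by
  have hs : 0 < Real.sqrt (C + u ^ 2) := Real.sqrt_pos.mpr (by positivity)
  rw [div_eq_zero_iff] at h
  rcases h with h | h
  · have : B * C - u * A = 0 := by
      rcases mul_eq_zero.mp h with h | h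
      · linarith
      · exact h
    linarith
  · exact absurd h (by positivity)

/-- Theorem 1 for the maximization problem: every local maximizer of `h_i` on
`V` is one of the finitely many KKT candidate points of Table 1, and in each
case the stated first-order conditions hold. -/
theorem stmt_17 (b γa γe xi yi zi : ℝ) (hb : 0 < b) (hγa : 0 < γa) (hγe : 0 < γe)
    (hne : (xi, yi, zi) ≠ ((0 : ℝ), (0 : ℝ), (0 : ℝ)))
    (v : ℝ × ℝ) (hv : v ∈ Vbox γa γe)
    (hmax : IsLocalMaxOn (hfun b xi yi zi) (Vbox γa γe) v) :
    (|v.1| < γa ∧ |v.2| < γe → xi ≠ 0 ∧ v = (yi / xi, zi / xi)) ∧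
    (v.1 = -γa ∧ |v.2| < γe →
      v.2 * (xi - γa * yi) = (1 + γa ^ 2) * zi ∧
      deriv (fun u => hfun b xi yi zi (u, v.2)) v.1 ≤ 0) ∧
    (v.1 = γa ∧ |v.2| < γe →
      v.2 * (xi + γa * yi) = (1 + γa ^ 2) * zi ∧
      0 ≤ deriv (fun u => hfun b xi yi zi (u, v.2)) v.1) ∧
    (|v.1| < γa ∧ v.2 = -γe →
      v.1 * (xi - γe * zi) = (1 + γe ^ 2) * yi ∧
      deriv (fun u => hfun b xi yi zi (v.1, u)) v.2 ≤ 0) ∧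
    (|v.1| < γa ∧ v.2 = γe →
      v.1 * (xi + γe * zi) = (1 + γe ^ 2) * yi ∧
      0 ≤ deriv (fun u => hfun b xi yi zi (v.1, u)) v.2) ∧
    (|v.1| = γa ∧ |v.2| = γe →
      (v.1 = -γa → deriv (fun u => hfun b xi yi zi (u, v.2)) v.1 ≤ 0) ∧
      (v.1 = γa → 0 ≤ deriv (fun u => hfun b xi yi zi (u, v.2)) v.1) ∧
      (v.2 = -γe → deriv (fun u => hfun b xi yi zi (v.1, u)) v.2 ≤ 0) ∧
      (v.2 = γe → 0 ≤ deriv (fun u => hfun b xi yi zi (v.1, u)) v.2)) := by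
  obtain ⟨p, q⟩ := v
  obtain ⟨hp, hq⟩ := hv
  simp only at hp hq
  have e1 : (fun u => hfun b xi yi zi (u, q)) = fun u : ℝ =>
      -2 * b * ((xi + zi * q) + yi * u) / Real.sqrt ((1 + q ^ 2) + u ^ 2)
        + ((xi ^ 2 + yi ^ 2 + zi ^ 2) + b ^ 2) := by
    funext u
    simp only [hfun]
    rw [show 1 + u ^ 2 + q ^ 2 = 1 + q ^ 2 + u ^ 2 by ring]
    ring
  have e2 : (fun u => hfun b xi yi zi (p, u)) = fun u : ℝ =>
      -2 * b * ((xi + yi * p) + zi * u) / Real.sqrt ((1 + p ^ 2) + u ^ 2)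
        + ((xi ^ 2 + yi ^ 2 + zi ^ 2) + b ^ 2) := by
    funext u
    simp only [hfun]
    ring
  have d1 := aux_deriv b (xi + zi * q) yi (1 + q ^ 2)
    ((xi ^ 2 + yi ^ 2 + zi ^ 2) + b ^ 2) (by positivity) p
  have d2 := aux_deriv b (xi + yi * p) zi (1 + p ^ 2)
    ((xi ^ 2 + yi ^ 2 + zi ^ 2) + b ^ 2) (by positivity) q
  rw [← e1] at d1
  rw [← e2] at d2
  have m1 : IsLocalMaxOn (fun u => hfun b xi yi zi (u, q)) (Set.Icc (-γa) γa) p := by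
    have ht : Filter.Tendsto (fun u : ℝ => (u, q)) (nhdsWithin p (Set.Icc (-γa) γa))
        (nhdsWithin (p, q) (Vbox γa γe)) := by
      apply ContinuousWithinAt.tendsto_nhdsWithin
      · fun_prop
      · intro u hu
        exact ⟨hu, hq⟩
    exact ht.eventually hmax
  have m2 : IsLocalMaxOn (fun u => hfun b xi yi zi (p, u)) (Set.Icc (-γe) γe) q := by
    have ht : Filter.Tendsto (fun u : ℝ => (p, u)) (nhdsWithin q (Set.Icc (-γe) γe))
        (nhdsWithin (p, q) (Vbox γa γe)) := by
      apply ContinuousWithinAt.tendsto_nhdsWithin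
      · fun_prop
      · intro u hu
        exact ⟨hp, hu⟩
    exact ht.eventually hmax
  obtain ⟨a0, a1, a2⟩ := aux_max _ γa p hγa d1.differentiableAt m1
  obtain ⟨c0, c1, c2⟩ := aux_max _ γe q hγe d2.differentiableAt m2
  have z1 : |p| < γa → p * (xi + zi * q) = (1 + q ^ 2) * yi := fun h =>
    aux_zero b _ _ _ _ hb (by positivity) (d1.deriv ▸ a0 h)
  have z2 : |q| < γe → q * (xi + yi * p) = (1 + p ^ 2) * zi := fun h =>
    aux_zero b _ _ _ _ hb (by positivity) (d2.deriv ▸ c0 h)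
  simp only
  refine ⟨?_, ?_, ?_, ?_, ?_, fun _ => ⟨a1, a2, c1, c2⟩⟩
  · rintro ⟨h1, h2⟩
    have k1 := z1 h1
    have k2 := z2 h2
    have hr : 0 < 1 + p ^ 2 + q ^ 2 := by positivity
    have l1 : p * xi = yi := by
      apply mul_left_cancel₀ hr.ne'
      linear_combination (1 + p ^ 2) * k1 + p * q * k2
    have l2 : q * xi = zi := by
      apply mul_left_cancel₀ hr.ne'
      linear_combination (1 + q ^ 2) * k2 + p * q * k1
    have hx : xi ≠ 0 := by
      rintro rfl
      apply hne
      simp [← l1, ← l2]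
    refine ⟨hx, ?_⟩
    rw [Prod.mk.injEq, eq_div_iff hx, eq_div_iff hx]
    exact ⟨l1, l2⟩
  · rintro ⟨h1, h2⟩
    refine ⟨?_, a1 h1⟩
    have := z2 h2
    subst h1
    linear_combination this
  · rintro ⟨h1, h2⟩
    refine ⟨?_, a2 h1⟩
    have := z2 h2
    subst h1
    linear_combination this
  · rintro ⟨h1, h2⟩
    refine ⟨?_, c1 h2⟩
    have := z1 h1
    subst h2
    linear_combination this
  · rintro ⟨h1, h2⟩
    refine ⟨?_, c2 h2⟩
    have := z1 h1
    subst h2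
    linear_combination this
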